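/- There exist a real number A > 1, a constant pair c, C > 0, and j₁ ∈ ℕ such that for every integer j ≥ j₁, the j-th Littlewood–Paley piece of Riemann's non-differentiable function, Δ_j R(x) = ∑_{A^j ≤ n < A^{j+1}} (σ_n/n) e^{2πinx}, satisfies c · A^{-3j/4} · (log A^j)^{1/4} ≤ ‖Δ_j R‖_{L⁴(𝕋)} ≤ C · A^{-3j/4} · (log A^j)^{1/4}. -/

import Mathlib

open Real MeasureTheory

/-- `σ k = 1` if `k` is a perfect square, `0` otherwise. -/
noncomputable def sqIndicator (k : ℕ) : ℝ := if IsSquare k then 1 else 0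

/-- The character `e_k(x) = e^{2πikx}`. -/
noncomputable def eChar (k : ℕ) (x : ℝ) : ℂ :=
  Complex.exp (2 * Real.pi * Complex.I * (k : ℂ) * (x : ℂ))

/-- Riemann's non-differentiable function `R(x) = ∑_{k≥1} (σ_k/k) e^{2πikx}
    = ∑_{n≥1} e^{2πin²x}/n²`. -/
noncomputable def RiemannF (x : ℝ) : ℂ :=
  ∑' k : ℕ, ((sqIndicator k / k : ℝ) : ℂ) * eChar k x

/-- High-pass filter `R_{≥N}(x) = ∑_{k ≥ N} (σ_k/k) e^{2πikx}`. -/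
noncomputable def RiemannHigh (N : ℕ) (x : ℝ) : ℂ :=
  ∑' k : ℕ, if N ≤ k then ((sqIndicator k / k : ℝ) : ℂ) * eChar k x else 0

/-- The `j`-th Littlewood–Paley piece of Riemann's function (with base `A`):
`Δ_j R(x) = ∑_{A^j ≤ n < A^{j+1}} (σ_n/n) e^{2πinx}`. -/
noncomputable def LPpiece (A : ℝ) (j : ℕ) (x : ℝ) : ℂ :=
  ∑' n : ℕ, if A ^ j ≤ (n : ℝ) ∧ (n : ℝ) < A ^ (j + 1)
    then ((sqIndicator n / n : ℝ) : ℂ) * eChar n x else 0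

/-- Quadruples `((a, b), (c, d))` from `S` with `a² + b² = c² + d²`. -/
def sqQuadruples (S : Finset ℕ) : Finset ((ℕ × ℕ) × (ℕ × ℕ)) :=
  ((S ×ˢ S) ×ˢ (S ×ˢ S)).filter fun t => t.1.1 ^ 2 + t.1.2 ^ 2 = t.2.1 ^ 2 + t.2.2 ^ 2

lemma eChar_add (k l : ℕ) (x : ℝ) : eChar (k + l) x = eChar k x * eChar l x := by
  simp only [eChar, ← Complex.exp_add]
  congr 1
  push_cast
  ring

lemma integral_eChar_mul_conj (k l : ℕ) :
    ∫ x in (0:ℝ)..1, eChar k x * (starRingEnd ℂ) (eChar l x) = if k = l then 1 else 0 := by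
  have h : ∀ x : ℝ, eChar k x * (starRingEnd ℂ) (eChar l x) =
      Complex.exp ((2 * Real.pi * Complex.I * ((k : ℂ) - l)) * (x : ℂ)) := by
    intro x
    simp only [eChar, ← Complex.exp_conj, ← Complex.exp_add]
    congr 1
    simp only [map_mul, Complex.conj_ofReal, Complex.conj_I, map_natCast, map_ofNat]
    ring
  simp only [h]
  split_ifs with hkl
  · simp [hkl]
  · have hne : (k : ℂ) - l ≠ 0 := by
      rw [sub_ne_zero]
      exact_mod_cast hkl
    rw [integral_exp_mul_complex (mul_ne_zero Complex.two_pi_I_ne_zero hne)]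
    have he : Complex.exp (2 * Real.pi * Complex.I * ((k : ℂ) - l) * ((1 : ℝ) : ℂ)) = 1 := by
      rw [Complex.exp_eq_one_iff]
      exact ⟨(k : ℤ) - l, by push_cast; ring⟩
    rw [he]
    simp

lemma continuous_eChar (k : ℕ) : Continuous (eChar k) := by
  unfold eChar
  fun_prop

/-- The fourth moment of a quadratic exponential sum counts the quadruples with
`a² + b² = c² + d²`. -/
lemma integral_norm_pow_four_eq (S : Finset ℕ) (w : ℕ → ℝ) :
    ∫ x in (0:ℝ)..1, ‖∑ m ∈ S, (w m : ℂ) * eChar (m ^ 2) x‖ ^ 4 =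
      ∑ t ∈ sqQuadruples S, w t.1.1 * w t.1.2 * (w t.2.1 * w t.2.2) := by
  have h : ∀ x : ℝ, ((‖∑ m ∈ S, (w m : ℂ) * eChar (m ^ 2) x‖ ^ 4 : ℝ) : ℂ) =
      ∑ t ∈ (S ×ˢ S) ×ˢ (S ×ˢ S), ((w t.1.1 * w t.1.2 * (w t.2.1 * w t.2.2) : ℝ) : ℂ) *
        (eChar (t.1.1 ^ 2 + t.1.2 ^ 2) x *
          (starRingEnd ℂ) (eChar (t.2.1 ^ 2 + t.2.2 ^ 2) x)) := by
    intro x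
    set f := ∑ m ∈ S, (w m : ℂ) * eChar (m ^ 2) x with hf
    have h1 : ((‖f‖ ^ 4 : ℝ) : ℂ) = (f * f) * (starRingEnd ℂ) (f * f) := by
      rw [Complex.mul_conj, Complex.normSq_eq_norm_sq, norm_mul]
      push_cast
      ring
    have h2 : f * f = ∑ t ∈ S ×ˢ S, ((w t.1 * w t.2 : ℝ) : ℂ) * eChar (t.1 ^ 2 + t.2 ^ 2) x := by
      rw [hf, Finset.sum_mul_sum, Finset.sum_product]
      refine Finset.sum_congr rfl fun a _ => Finset.sum_congr rfl fun b _ => ?_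
      rw [eChar_add]
      push_cast
      ring
    rw [h1, h2, map_sum, Finset.sum_mul_sum, Finset.sum_product (S ×ˢ S) (S ×ˢ S)]
    refine Finset.sum_congr rfl fun a _ => Finset.sum_congr rfl fun b _ => ?_
    rw [map_mul, Complex.conj_ofReal]
    push_cast
    ring
  have hc : ∀ k l : ℕ, Continuous fun x => eChar k x * (starRingEnd ℂ) (eChar l x) :=
    fun k l => (continuous_eChar k).mul (Complex.continuous_conj.comp (continuous_eChar l))
  apply Complex.ofReal_injective
  rw [← intervalIntegral.integral_ofReal]
  simp only [h]
  rw [intervalIntegral.integral_finsetSum fun t _ =>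
    (Continuous.intervalIntegrable (by have := hc (t.1.1 ^ 2 + t.1.2 ^ 2) (t.2.1 ^ 2 + t.2.2 ^ 2)
                                       fun_prop) _ _)]
  simp only [intervalIntegral.integral_const_mul, integral_eChar_mul_conj]
  rw [sqQuadruples, Finset.sum_filter]
  push_cast
  refine Finset.sum_congr rfl fun t _ => ?_
  split_ifs <;> simp

/-- Dyadic-type pieces of Riemann's function as sums over the square roots of the frequencies. -/
lemma LPpiece_eq_sum (B j : ℕ) (x : ℝ) :
    LPpiece ((B : ℝ) ^ 4) j x = ∑ m ∈ Finset.Ico (B ^ (2 * j)) (B ^ (2 * j + 2)),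
      (((1 / (m : ℝ) ^ 2 : ℝ)) : ℂ) * eChar (m ^ 2) x := by
  have hcond : ∀ m : ℕ, (((B : ℝ) ^ 4) ^ j ≤ ((m ^ 2 : ℕ) : ℝ) ∧
      ((m ^ 2 : ℕ) : ℝ) < ((B : ℝ) ^ 4) ^ (j + 1)) ↔
      m ∈ Finset.Ico (B ^ (2 * j)) (B ^ (2 * j + 2)) := by
    intro m
    rw [Finset.mem_Ico, ← Nat.pow_le_pow_iff_left two_ne_zero,
      ← Nat.pow_lt_pow_iff_left two_ne_zero]
    rw [show (B ^ (2 * j)) ^ 2 = (B ^ 4) ^ j by ring,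
      show (B ^ (2 * j + 2)) ^ 2 = (B ^ 4) ^ (j + 1) by ring]
    norm_cast
  have hinj : Set.InjOn (fun m : ℕ => m ^ 2)
      (Finset.Ico (B ^ (2 * j)) (B ^ (2 * j + 2)) : Set ℕ) :=
    fun a _ b _ h => Nat.pow_left_injective two_ne_zero h
  rw [LPpiece, tsum_eq_sum
    (s := (Finset.Ico (B ^ (2 * j)) (B ^ (2 * j + 2))).image fun m => m ^ 2),
    Finset.sum_image hinj]
  · refine Finset.sum_congr rfl fun m hm => ?_
    rw [if_pos ((hcond m).2 hm), sqIndicator, if_pos (IsSquare.sq m)]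
    push_cast
    ring
  · intro n hn
    by_cases hs : IsSquare n
    · obtain ⟨r, rfl⟩ := hs
      rw [if_neg]
      intro hr
      rw [← sq, hcond] at hr
      exact hn (Finset.mem_image.2 ⟨r, hr, sq r⟩)
    · simp [sqIndicator, hs]

lemma sum_Icc_two_inv_sq_le (N : ℕ) (hN : 2 ≤ N) :
    ∑ d ∈ Finset.Icc 2 N, 1 / (d : ℝ) ^ 2 ≤ 3 / 4 - 1 / (N : ℝ) := by
  induction N, hN using Nat.le_induction with
  | base => norm_num
  | succ n hn ih =>
    rw [Finset.sum_Icc_succ_top (by omega)]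
    have hn0 : (0 : ℝ) < n := by positivity
    have : 1 / ((n + 1 : ℕ) : ℝ) ^ 2 ≤ 1 / (n : ℝ) - 1 / ((n + 1 : ℕ) : ℝ) := by
      push_cast
      rw [div_sub_div _ _ (by positivity) (by positivity), div_le_div_iff₀ (by positivity)
        (by positivity)]
      nlinarith
    linarith

/-- At least a quarter of the pairs of positive integers up to `N` are coprime. -/
lemma sq_le_four_mul_card_coprime (N : ℕ) :
    (N : ℝ) ^ 2 / 4 ≤
      (((Finset.Ioc 0 N ×ˢ Finset.Ioc 0 N).filter fun t => Nat.Coprime t.1 t.2).card : ℝ) := by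
  rcases Nat.lt_or_ge N 2 with hN | hN
  · interval_cases N
    · norm_num
    · norm_num [Finset.filter_singleton]
  set U := Finset.Ioc 0 N ×ˢ Finset.Ioc 0 N with hU
  have hsplit := Finset.card_filter_add_card_filter_not (s := U)
    (fun t : ℕ × ℕ => Nat.Coprime t.1 t.2)
  have hUc : U.card = N * N := by simp [hU]
  have hsub : (U.filter fun t => ¬ Nat.Coprime t.1 t.2) ⊆ (Finset.Icc 2 N).biUnion fun d =>
      (Finset.Ioc 0 N).filter (d ∣ ·) ×ˢ (Finset.Ioc 0 N).filter (d ∣ ·) := by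
    rintro ⟨p, q⟩ h
    simp only [hU, Finset.mem_filter, Finset.mem_product, Finset.mem_Ioc] at h
    obtain ⟨⟨⟨hp, hpN⟩, hq, hqN⟩, hc⟩ := h
    simp only [Finset.mem_biUnion, Finset.mem_filter, Finset.mem_product, Finset.mem_Ioc,
      Finset.mem_Icc]
    have h0 : 0 < Nat.gcd p q := Nat.gcd_pos_of_pos_left _ hp
    have h1 : Nat.gcd p q ≠ 1 := hc
    exact ⟨Nat.gcd p q, ⟨by omega, (Nat.gcd_le_left _ hp).trans hpN⟩,
      ⟨⟨hp, hpN⟩, Nat.gcd_dvd_left _ _⟩, ⟨hq, hqN⟩, Nat.gcd_dvd_right _ _⟩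
  have hcard := (Finset.card_le_card hsub).trans Finset.card_biUnion_le
  simp only [Finset.card_product, Nat.Ioc_filter_dvd_card_eq_div] at hcard
  have hcard' : ((U.filter fun t => ¬ Nat.Coprime t.1 t.2).card : ℝ) ≤ (N : ℝ) ^ 2 * (3 / 4) := by
    calc ((U.filter fun t => ¬ Nat.Coprime t.1 t.2).card : ℝ)
        ≤ ∑ d ∈ Finset.Icc 2 N, (((N / d : ℕ) : ℝ) * ((N / d : ℕ) : ℝ)) := by exact_mod_cast hcard
      _ ≤ ∑ d ∈ Finset.Icc 2 N, (N : ℝ) ^ 2 * (1 / (d : ℝ) ^ 2) := by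
          refine Finset.sum_le_sum fun d _ => ?_
          have h1 : ((N / d : ℕ) : ℝ) ≤ (N : ℝ) / d := Nat.cast_div_le
          calc ((N / d : ℕ) : ℝ) * ((N / d : ℕ) : ℝ) ≤ ((N : ℝ) / d) * ((N : ℝ) / d) := by gcongr
            _ = _ := by ring
      _ ≤ (N : ℝ) ^ 2 * (3 / 4) := by
          rw [← Finset.mul_sum]
          gcongr
          have h1 : (0 : ℝ) ≤ 1 / N := by positivity
          linarith [sum_Icc_two_inv_sq_le N hN]
  have hsplit' : ((U.filter fun t => Nat.Coprime t.1 t.2).card : ℝ) +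
      ((U.filter fun t => ¬ Nat.Coprime t.1 t.2).card : ℝ) = N * N := by
    rw [hUc] at hsplit
    exact_mod_cast hsplit
  nlinarith

/-- A positive proportion of the pairs in `(n, 64 n]²` are coprime. -/
lemma card_coprime_Ioc_ge (n : ℕ) :
    (64 * n) ^ 2 ≤ 8 * ((Finset.Ioc n (64 * n) ×ˢ Finset.Ioc n (64 * n)).filter
      fun t => Nat.Coprime t.1 t.2).card := by
  have h := sq_le_four_mul_card_coprime (64 * n)
  have hsub : ((Finset.Ioc 0 (64 * n) ×ˢ Finset.Ioc 0 (64 * n)).filter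
      fun t => Nat.Coprime t.1 t.2) ⊆
      ((Finset.Ioc n (64 * n) ×ˢ Finset.Ioc n (64 * n)).filter fun t => Nat.Coprime t.1 t.2) ∪
      (Finset.Ioc 0 n ×ˢ Finset.Ioc 0 (64 * n) ∪ Finset.Ioc 0 (64 * n) ×ˢ Finset.Ioc 0 n) := by
    rintro ⟨p, q⟩ h
    simp only [Finset.mem_filter, Finset.mem_product, Finset.mem_Ioc, Finset.mem_union] at h ⊢
    by_cases h1 : p ≤ n
    · tauto
    · by_cases h2 : q ≤ n
      · tauto
      · have : n < p ∧ n < q := by omega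
        tauto
  have hcard := (Finset.card_le_card hsub).trans ((Finset.card_union_le _ _).trans
    (Nat.add_le_add_left (Finset.card_union_le _ _) _))
  simp only [Finset.card_product, Nat.card_Ioc, Nat.sub_zero] at hcard
  have h4 : (64 * n) ^ 2 ≤ 4 * ((Finset.Ioc 0 (64 * n) ×ˢ Finset.Ioc 0 (64 * n)).filter
      fun t => Nat.Coprime t.1 t.2).card := by
    have : (((64 * n) ^ 2 : ℕ) : ℝ) ≤ ((4 * ((Finset.Ioc 0 (64 * n) ×ˢ
        Finset.Ioc 0 (64 * n)).filter fun t => Nat.Coprime t.1 t.2).card : ℕ) : ℝ) := by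
      rw [Nat.cast_pow, Nat.cast_mul 4]
      push_cast at h ⊢
      linarith
    exact_mod_cast this
  nlinarith

lemma eq_of_mul_eq_of_coprime {p q r s : ℕ} (h : p * s = r * q) (hpq : p.Coprime q)
    (hrs : r.Coprime s) : p = r ∧ q = s := by
  have h1 : p = r := Nat.dvd_antisymm (hpq.dvd_of_dvd_mul_right (h ▸ Dvd.intro _ rfl))
    (hrs.dvd_of_dvd_mul_right (h ▸ Dvd.intro _ rfl))
  have h2 : q = s := Nat.dvd_antisymm
    (hpq.symm.dvd_of_dvd_mul_left (h ▸ Dvd.intro_left _ rfl))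
    (hrs.symm.dvd_of_dvd_mul_left (h ▸ Dvd.intro_left _ rfl))
  exact ⟨h1, h2⟩

/-- Lower bound for the number of solutions of `a² + b² = c² + d²`, from the family
`a, c = hq ± gp`, `d, b = hp ± gq` with `p`, `q` coprime. -/
lemma card_sqQuadruples_ge (k : ℕ) :
    16 * k * (64 ^ k) ^ 2 ≤
      (sqQuadruples (Finset.Ico (64 ^ k) (64 ^ (k + 2)))).card := by
  let D : Finset (Σ _ : ℕ, (ℕ × ℕ) × (ℕ × ℕ)) := (Finset.range k).sigma fun i =>
    ((Finset.Ioc (64 ^ i) (64 * 64 ^ i) ×ˢ Finset.Ioc (64 ^ i) (64 * 64 ^ i)).filter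
      fun t : ℕ × ℕ => Nat.Coprime t.1 t.2) ×ˢ
      (Finset.Icc 1 (64 ^ (k - 1 - i)) ×ˢ
        Finset.Ico (128 * 64 ^ (k - 1 - i)) (256 * 64 ^ (k - 1 - i)))
  let F : (Σ _ : ℕ, (ℕ × ℕ) × (ℕ × ℕ)) → (ℕ × ℕ) × (ℕ × ℕ) := fun t =>
    ((t.2.2.2 * t.2.1.2 + t.2.2.1 * t.2.1.1, t.2.2.2 * t.2.1.1 - t.2.2.1 * t.2.1.2),
      (t.2.2.2 * t.2.1.2 - t.2.2.1 * t.2.1.1, t.2.2.2 * t.2.1.1 + t.2.2.1 * t.2.1.2))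
  have key : ∀ t ∈ D, t.1 < k ∧ 64 ^ t.1 < t.2.1.1 ∧ t.2.1.1 ≤ 64 ^ (t.1 + 1) ∧
      t.2.1.1.Coprime t.2.1.2 ∧ 0 < t.2.2.1 ∧ 0 < t.2.2.2 ∧
      t.2.2.1 * t.2.1.1 ≤ 64 ^ k ∧ t.2.2.1 * t.2.1.2 ≤ 64 ^ k ∧
      2 * 64 ^ k ≤ t.2.2.2 * t.2.1.1 ∧ t.2.2.2 * t.2.1.1 ≤ 256 * 64 ^ k ∧
      2 * 64 ^ k ≤ t.2.2.2 * t.2.1.2 ∧ t.2.2.2 * t.2.1.2 ≤ 256 * 64 ^ k := by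
    rintro ⟨i, ⟨p, q⟩, g, h⟩ ht
    simp only [D, Finset.mem_sigma, Finset.mem_range, Finset.mem_product, Finset.mem_filter,
      Finset.mem_Ioc, Finset.mem_Icc, Finset.mem_Ico] at ht
    obtain ⟨hi, ⟨⟨⟨hp, hp'⟩, hq, hq'⟩, hc⟩, ⟨hg, hg'⟩, hh, hh'⟩ := ht
    have hM : 64 ^ k = 64 ^ (k - 1 - i) * (64 * 64 ^ i) := by
      rw [← pow_succ', ← pow_add]
      congr 1
      omega
    have hL : 0 < 64 ^ (k - 1 - i) := by positivity
    refine ⟨hi, hp, by rw [pow_succ']; exact hp', hc, hg,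
      lt_of_lt_of_le (by positivity) hh, ?_, ?_, ?_, ?_, ?_, ?_⟩ <;>
      dsimp only
    · rw [hM]; exact Nat.mul_le_mul hg' hp'
    · rw [hM]; exact Nat.mul_le_mul hg' hq'
    · exact le_trans (by rw [hM]; apply le_of_eq; ring) (Nat.mul_le_mul hh hp.le)
    · exact (Nat.mul_le_mul hh'.le hp').trans (by rw [hM]; apply le_of_eq; ring)
    · exact le_trans (by rw [hM]; apply le_of_eq; ring) (Nat.mul_le_mul hh hq.le)
    · exact (Nat.mul_le_mul hh'.le hq').trans (by rw [hM]; apply le_of_eq; ring)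
  have hmaps : ∀ t ∈ D, F t ∈ sqQuadruples (Finset.Ico (64 ^ k) (64 ^ (k + 2))) := by
    intro t ht
    obtain ⟨-, -, -, -, -, -, h1, h2, h3, h4, h5, h6⟩ := key t ht
    have hM : 0 < 64 ^ k := by positivity
    have hK : 64 ^ (k + 2) = 4096 * 64 ^ k := by ring
    simp only [F, sqQuadruples, Finset.mem_filter, Finset.mem_product, Finset.mem_Ico, hK]
    refine ⟨by omega, ?_⟩
    zify [show t.2.2.1 * t.2.1.2 ≤ t.2.2.2 * t.2.1.1 by omega,
      show t.2.2.1 * t.2.1.1 ≤ t.2.2.2 * t.2.1.2 by omega]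
    ring
  have hinj : Set.InjOn F (D : Set (Σ _ : ℕ, (ℕ × ℕ) × (ℕ × ℕ))) := by
    intro t ht t' ht' hF
    obtain ⟨-, a1, a2, a3, a4, a5, h1, h2, h3, h4, h5, h6⟩ := key t ht
    obtain ⟨-, b1, b2, b3, b4, b5, h1', h2', h3', h4', h5', h6'⟩ := key t' ht'
    obtain ⟨i, ⟨p, q⟩, g, h⟩ := t
    obtain ⟨i', ⟨p', q'⟩, g', h'⟩ := t'
    simp only [F, Prod.mk.injEq] at *
    obtain ⟨⟨e1, e2⟩, e3, e4⟩ := hF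
    have hM : 0 < 64 ^ k := by positivity
    have f1 : h * q = h' * q' := by omega
    have f2 : g * p = g' * p' := by omega
    have f3 : h * p = h' * p' := by omega
    have f5 : p * q' = p' * q := by
      have : (h * h') * (p * q') = (h * h') * (p' * q) := by
        calc (h * h') * (p * q') = (h * p) * (h' * q') := by ring
          _ = (h' * p') * (h * q) := by rw [f3, f1]
          _ = _ := by ring
      exact Nat.eq_of_mul_eq_mul_left (Nat.mul_pos a5 b5) this
    obtain ⟨rfl, rfl⟩ := eq_of_mul_eq_of_coprime f5 a3 b3
    have hp : 0 < p := by omega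
    obtain rfl := Nat.eq_of_mul_eq_mul_right hp f2
    obtain rfl := Nat.eq_of_mul_eq_mul_right hp f3
    have i1 : i < i' + 1 := (Nat.pow_lt_pow_iff_right (by norm_num)).1 (a1.trans_le b2)
    have i2 : i' < i + 1 := (Nat.pow_lt_pow_iff_right (by norm_num)).1 (b1.trans_le a2)
    obtain rfl : i = i' := by omega
    rfl
  have hD : 16 * k * (64 ^ k) ^ 2 ≤ D.card := by
    have hk : 16 * k * (64 ^ k) ^ 2 = ∑ _i ∈ Finset.range k, 16 * (64 ^ k) ^ 2 := by
      rw [Finset.sum_const, Finset.card_range, smul_eq_mul]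
      ring
    rw [Finset.card_sigma, hk]
    refine Finset.sum_le_sum fun i hi => ?_
    rw [Finset.mem_range] at hi
    simp only [Finset.card_product, Nat.card_Icc, Nat.card_Ico]
    have hc := card_coprime_Ioc_ge (64 ^ i)
    have hM : 64 ^ k = 64 ^ (k - 1 - i) * (64 * 64 ^ i) := by
      rw [← pow_succ', ← pow_add]
      congr 1
      omega
    have hs : 256 * 64 ^ (k - 1 - i) - 128 * 64 ^ (k - 1 - i) = 128 * 64 ^ (k - 1 - i) := by omega
    rw [hM, hs, Nat.add_sub_cancel]
    calc 16 * (64 ^ (k - 1 - i) * (64 * 64 ^ i)) ^ 2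
        = (64 * 64 ^ i) ^ 2 * (16 * (64 ^ (k - 1 - i)) ^ 2) := by ring
      _ ≤ _ := Nat.mul_le_mul_right _ hc
      _ = _ := by ring
  exact hD.trans (Finset.card_le_card_of_injOn F hmaps hinj)

/-- The factorizations `(gp)(qh) = (gq)(ph)` with `p ≤ q`, indexed by `(q, p, g, h)`. -/
def factorParams (P : ℕ) : Finset (Σ _ : ℕ, ℕ × (ℕ × ℕ)) :=
  (Finset.Icc 1 P).sigma fun q =>
    Finset.Icc 1 q ×ˢ (Finset.Icc 1 (P / q) ×ˢ Finset.Icc 1 (2 * P / q))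

lemma card_factorParams_le (P : ℕ) :
    ((factorParams P).card : ℝ) ≤ 2 * (P : ℝ) ^ 2 * (1 + Real.log P) := by
  have hh := harmonic_le_one_add_log P
  rw [harmonic_eq_sum_Icc] at hh
  push_cast at hh
  calc ((factorParams P).card : ℝ)
      ≤ ∑ q ∈ Finset.Icc 1 P, 2 * (P : ℝ) ^ 2 * (q : ℝ)⁻¹ := by
        rw [factorParams, Finset.card_sigma]
        push_cast
        refine Finset.sum_le_sum fun q hq => ?_
        have hq0 : (0 : ℝ) < q := by exact_mod_cast (Finset.mem_Icc.1 hq).1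
        simp only [Finset.card_product, Nat.card_Icc, Nat.add_sub_cancel]
        push_cast
        have h1 : ((P / q : ℕ) : ℝ) ≤ (P : ℝ) / q := Nat.cast_div_le
        have h2 : ((2 * P / q : ℕ) : ℝ) ≤ 2 * P / q := by
          exact_mod_cast (Nat.cast_div_le (α := ℝ) (m := 2 * P) (n := q))
        calc (q : ℝ) * (((P / q : ℕ) : ℝ) * ((2 * P / q : ℕ) : ℝ))
            ≤ q * (((P : ℝ) / q) * (2 * P / q)) := by gcongr
          _ = _ := by field_simp
    _ ≤ 2 * (P : ℝ) ^ 2 * (1 + Real.log P) := by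
        rw [← Finset.mul_sum]
        gcongr

/-- The pairs `(a, b)`, `(c, d)` with `a ± c = qh, gp` and `d ± b = ph, gq`. -/
def quadrupleOfParams (t : Σ _ : ℕ, ℕ × (ℕ × ℕ)) : (ℕ × ℕ) × (ℕ × ℕ) :=
  (((t.2.2.1 * t.2.1 + t.1 * t.2.2.2) / 2, (t.2.1 * t.2.2.2 - t.2.2.1 * t.1) / 2),
    ((t.1 * t.2.2.2 - t.2.2.1 * t.2.1) / 2, (t.2.1 * t.2.2.2 + t.2.2.1 * t.1) / 2))

lemma mem_image_of_lt {P a b c d : ℕ} (ha : a ≤ P) (hd : d ≤ P) (hac : c < a)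
    (h : a ^ 2 + b ^ 2 = c ^ 2 + d ^ 2) :
    ((a, b), (c, d)) ∈ (factorParams P).image quadrupleOfParams ∨
    ((d, c), (b, a)) ∈ (factorParams P).image quadrupleOfParams := by
  have hbd : b < d := by
    by_contra! hdb
    nlinarith [Nat.pow_le_pow_left hdb 2, Nat.pow_lt_pow_left hac two_ne_zero]
  obtain ⟨u, rfl⟩ := Nat.exists_eq_add_of_lt hac
  obtain ⟨s, rfl⟩ := Nat.exists_eq_add_of_lt hbd
  have hus : (u + 1) * (c + u + 1 + c) = (s + 1) * (b + s + 1 + b) := by nlinarith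
  obtain ⟨g, p, ⟨q, hq⟩, ⟨r, hr⟩, hu⟩ := exists_dvd_and_dvd_of_dvd_mul (Dvd.intro _ hus)
  have hg : 0 < g := Nat.pos_of_ne_zero fun h0 => by simp [h0] at hu
  have hp : 0 < p := Nat.pos_of_ne_zero fun h0 => by simp [h0] at hu
  have hq0 : 0 < q := Nat.pos_of_ne_zero fun h0 => by simp [h0] at hq
  have hr0 : 0 < r := Nat.pos_of_ne_zero fun h0 => by simp [h0] at hr
  have hv : c + u + 1 + c = q * r := by
    rw [hu, hq, hr] at hus
    have : (g * p) * (c + u + 1 + c) = (g * p) * (q * r) := by rw [hus]; ring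
    exact Nat.eq_of_mul_eq_mul_left (Nat.mul_pos hg hp) this
  simp only [Finset.mem_image, factorParams, Finset.mem_sigma, Finset.mem_product,
    Finset.mem_Icc, quadrupleOfParams, Prod.mk.injEq]
  rcases le_total p q with hpq | hpq
  · left
    refine ⟨⟨q, p, g, r⟩, ⟨⟨hq0, ?_⟩, ⟨hp, hpq⟩, ⟨hg, ?_⟩, hr0, ?_⟩, ⟨?_, ?_⟩, ?_, ?_⟩
    · nlinarith
    · rw [Nat.le_div_iff_mul_le hq0]; dsimp only; omega
    · rw [Nat.le_div_iff_mul_le hq0, mul_comm]; dsimp only; omega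
    all_goals dsimp only; omega
  · right
    refine ⟨⟨p, q, g, r⟩, ⟨⟨hp, ?_⟩, ⟨hq0, hpq⟩, ⟨hg, ?_⟩, hr0, ?_⟩, ⟨?_, ?_⟩, ?_, ?_⟩
    · nlinarith
    · rw [Nat.le_div_iff_mul_le hp]; dsimp only; omega
    · rw [Nat.le_div_iff_mul_le hp, mul_comm]; dsimp only; omega
    all_goals dsimp only; omega

lemma card_sqQuadruples_le (M P : ℕ) :
    ((sqQuadruples (Finset.Ico M P)).card : ℝ) ≤
      (P : ℝ) ^ 2 + 8 * (P : ℝ) ^ 2 * (1 + Real.log P) := by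
  set I := (factorParams P).image quadrupleOfParams with hI
  set J := I ∪ I.image fun t : (ℕ × ℕ) × (ℕ × ℕ) => ((t.2.2, t.2.1), (t.1.2, t.1.1)) with hJ
  have hIc : I.card ≤ (factorParams P).card := Finset.card_image_le
  have hJc : J.card ≤ 2 * (factorParams P).card :=
    calc J.card ≤ I.card + I.card :=
          (Finset.card_union_le _ _).trans (Nat.add_le_add_left Finset.card_image_le _)
      _ ≤ _ := by omega
  have hJmem : ∀ {a b c d : ℕ}, a ≤ P → d ≤ P → c < a → a ^ 2 + b ^ 2 = c ^ 2 + d ^ 2 →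
      ((a, b), (c, d)) ∈ J := by
    intro a b c d ha hd hac h
    rcases mem_image_of_lt ha hd hac h with h | h
    · exact Finset.mem_union_left _ h
    · exact Finset.mem_union_right _ (Finset.mem_image.2 ⟨_, h, rfl⟩)
  have hsub : sqQuadruples (Finset.Ico M P) ⊆
      (Finset.range P ×ˢ Finset.range P).image (fun t : ℕ × ℕ => (t, t)) ∪
        (J ∪ J.image Prod.swap) := by
    rintro ⟨⟨a, b⟩, c, d⟩ ht
    simp only [sqQuadruples, Finset.mem_filter, Finset.mem_product, Finset.mem_Ico] at ht
    obtain ⟨⟨⟨⟨-, ha⟩, -, hb⟩, ⟨-, hc⟩, -, hd⟩, h⟩ := ht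
    rcases lt_trichotomy a c with hac | rfl | hac
    · refine Finset.mem_union_right _ (Finset.mem_union_right _ (Finset.mem_image.2
        ⟨((c, d), (a, b)), hJmem hc.le hb.le hac h.symm, rfl⟩))
    · obtain rfl : b = d := Nat.pow_left_injective two_ne_zero (Nat.add_left_cancel h)
      exact Finset.mem_union_left _ (Finset.mem_image.2 ⟨(a, b), by simp [ha, hb], rfl⟩)
    · exact Finset.mem_union_right _ (Finset.mem_union_left _ (hJmem ha.le hd.le hac h))
  have hcard : (sqQuadruples (Finset.Ico M P)).card ≤ P * P + 4 * (factorParams P).card :=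
    calc (sqQuadruples (Finset.Ico M P)).card
        ≤ ((Finset.range P ×ˢ Finset.range P).image fun t : ℕ × ℕ => (t, t)).card +
          (J.card + (J.image Prod.swap).card) :=
          (Finset.card_le_card hsub).trans ((Finset.card_union_le _ _).trans
            (Nat.add_le_add_left (Finset.card_union_le _ _) _))
      _ ≤ (Finset.range P ×ˢ Finset.range P).card + (J.card + J.card) := by
          exact Nat.add_le_add Finset.card_image_le
            (Nat.add_le_add_left Finset.card_image_le _)
      _ ≤ _ := by
          simp only [Finset.card_product, Finset.card_range]
          omega
  have hcard' : ((sqQuadruples (Finset.Ico M P)).card : ℝ) ≤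
      P * P + 4 * ((factorParams P).card : ℝ) := by exact_mod_cast hcard
  linarith [card_factorParams_le P]

lemma mul_pow_four_mul_rpow_quarter {c X L : ℝ} (hc : 0 ≤ c) (hX : 0 ≤ X) (hL : 0 ≤ L) :
    (c * X ^ 4 * L) ^ ((1:ℝ)/4) = c ^ ((1:ℝ)/4) * X * L ^ ((1:ℝ)/4) := by
  rw [Real.mul_rpow (by positivity) hL, Real.mul_rpow hc (by positivity)]
  congr 2
  rw [← Real.rpow_natCast, ← Real.rpow_mul hX]
  norm_num

/-- Two-sided bounds for the fourth moment of the Littlewood–Paley pieces with base `64 ^ 4`. -/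
lemma integral_LPpiece_pow_four_bounds (j : ℕ) (hj : 1 ≤ j) :
    32 / 4096 ^ 8 * j / ((64 : ℝ) ^ (2 * j)) ^ 6 ≤
        ∫ x in (0:ℝ)..1, ‖LPpiece ((64 : ℝ) ^ 4) j x‖ ^ 4 ∧
      ∫ x in (0:ℝ)..1, ‖LPpiece ((64 : ℝ) ^ 4) j x‖ ^ 4 ≤
        4096 ^ 2 * (9 + 32 * Real.log 64) * j / ((64 : ℝ) ^ (2 * j)) ^ 6 := by
  have hLP := LPpiece_eq_sum 64 j
  rw [Nat.cast_ofNat] at hLP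
  simp only [hLP]
  rw [integral_norm_pow_four_eq _ (fun m : ℕ => 1 / (m : ℝ) ^ 2)]
  have hge := card_sqQuadruples_ge (2 * j)
  have hle := card_sqQuadruples_le (64 ^ (2 * j)) (64 ^ (2 * j + 2))
  set Q := sqQuadruples (Finset.Ico (64 ^ (2 * j)) (64 ^ (2 * j + 2))) with hQ
  set M : ℝ := (64 : ℝ) ^ (2 * j) with hM
  have hM0 : 0 < M := by positivity
  have hP : (((64 : ℕ) ^ (2 * j + 2) : ℕ) : ℝ) = 4096 * M := by
    rw [hM]; push_cast; ring
  have hge' : 32 * j * M ^ 2 ≤ (Q.card : ℝ) := by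
    have : ((16 * (2 * j) * (64 ^ (2 * j)) ^ 2 : ℕ) : ℝ) ≤ (Q.card : ℝ) := by exact_mod_cast hge
    push_cast at this
    rw [hM]
    linarith
  have hlog : Real.log (4096 * M) ≤ 4 * j * Real.log 64 := by
    have : 4096 * M = (64 : ℝ) ^ (2 * j + 2) := by rw [hM]; ring
    rw [this, Real.log_pow]
    have h0 : 0 < Real.log 64 := Real.log_pos (by norm_num)
    have h1 : (1 : ℝ) ≤ j := by exact_mod_cast hj
    gcongr
    push_cast
    linarith
  have hle' : (Q.card : ℝ) ≤ 4096 ^ 2 * (9 + 32 * Real.log 64) * j * M ^ 2 := by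
    rw [hP] at hle
    have h1 : (1 : ℝ) ≤ j := by exact_mod_cast hj
    calc (Q.card : ℝ) ≤ (4096 * M) ^ 2 * (9 + 8 * Real.log (4096 * M)) := by linarith
      _ ≤ (4096 * M) ^ 2 * (9 * j + 8 * (4 * j * Real.log 64)) := by gcongr; linarith
      _ = _ := by ring
  have hmem : ∀ m ∈ Finset.Ico ((64 : ℕ) ^ (2 * j)) (64 ^ (2 * j + 2)),
      1 / (4096 * M) ^ 2 ≤ 1 / (m : ℝ) ^ 2 ∧ 1 / (m : ℝ) ^ 2 ≤ 1 / M ^ 2 := by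
    intro m hm
    obtain ⟨h1, h2⟩ := Finset.mem_Ico.1 hm
    have h1' : M ≤ (m : ℝ) := by
      rw [hM]
      exact_mod_cast h1
    have h2' : (m : ℝ) ≤ 4096 * M := by
      rw [← hP]
      exact_mod_cast h2.le
    have : (0 : ℝ) < m := hM0.trans_le h1'
    constructor <;> gcongr
  have hQmem : ∀ t ∈ Q, 1 / (4096 * M) ^ 8 ≤ 1 / (t.1.1 : ℝ) ^ 2 * (1 / (t.1.2 : ℝ) ^ 2) *
        (1 / (t.2.1 : ℝ) ^ 2 * (1 / (t.2.2 : ℝ) ^ 2)) ∧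
      1 / (t.1.1 : ℝ) ^ 2 * (1 / (t.1.2 : ℝ) ^ 2) *
        (1 / (t.2.1 : ℝ) ^ 2 * (1 / (t.2.2 : ℝ) ^ 2)) ≤ 1 / M ^ 8 := by
    intro t ht
    simp only [hQ, sqQuadruples, Finset.mem_filter, Finset.mem_product] at ht
    obtain ⟨⟨⟨ha, hb⟩, hc, hd⟩, -⟩ := ht
    obtain ⟨a1, a2⟩ := hmem _ ha
    obtain ⟨b1, b2⟩ := hmem _ hb
    obtain ⟨c1, c2⟩ := hmem _ hc
    obtain ⟨d1, d2⟩ := hmem _ hd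
    constructor
    · calc 1 / (4096 * M) ^ 8 = 1 / (4096 * M) ^ 2 * (1 / (4096 * M) ^ 2) *
          (1 / (4096 * M) ^ 2 * (1 / (4096 * M) ^ 2)) := by field_simp
        _ ≤ _ := by gcongr
    · calc _ ≤ 1 / M ^ 2 * (1 / M ^ 2) * (1 / M ^ 2 * (1 / M ^ 2)) := by gcongr
        _ = 1 / M ^ 8 := by field_simp
  constructor
  · calc 32 / 4096 ^ 8 * j / M ^ 6 = 32 * j * M ^ 2 * (1 / (4096 * M) ^ 8) := by field_simp
      _ ≤ Q.card * (1 / (4096 * M) ^ 8) := by gcongr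
      _ ≤ _ := by
        rw [← nsmul_eq_mul]
        exact Finset.card_nsmul_le_sum _ _ _ fun t ht => (hQmem t ht).1
  · calc _ ≤ Q.card * (1 / M ^ 8) := by
          rw [← nsmul_eq_mul]
          exact Finset.sum_le_card_nsmul _ _ _ fun t ht => (hQmem t ht).2
      _ ≤ 4096 ^ 2 * (9 + 32 * Real.log 64) * j * M ^ 2 * (1 / M ^ 8) := by gcongr
      _ = _ := by field_simp

/-- There exist `A > 1`, constants `c, C > 0` and `j₁ ∈ ℕ` such that for every
`j ≥ j₁`, `c · A^{-3j/4} · (log A^j)^{1/4} ≤ ‖Δ_j R‖_{L⁴(𝕋)} ≤ C · A^{-3j/4} · (log A^j)^{1/4}`. -/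
theorem riemann_LP_piece_L4 :
    ∃ A : ℝ, 1 < A ∧ ∃ c C : ℝ, 0 < c ∧ 0 < C ∧ ∃ j₁ : ℕ, ∀ j : ℕ, j₁ ≤ j →
      c * A ^ (-(3 * (j : ℝ))/4) * (Real.log (A ^ j)) ^ ((1:ℝ)/4) ≤
        (∫ x in (0:ℝ)..1, ‖LPpiece A j x‖ ^ 4) ^ ((1:ℝ)/4) ∧
      (∫ x in (0:ℝ)..1, ‖LPpiece A j x‖ ^ 4) ^ ((1:ℝ)/4) ≤
        C * A ^ (-(3 * (j : ℝ))/4) * (Real.log (A ^ j)) ^ ((1:ℝ)/4) := by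
  have hlog : 0 < Real.log 64 := Real.log_pos (by norm_num)
  refine ⟨64 ^ 4, by norm_num, (32 / 4096 ^ 8 / (4 * Real.log 64)) ^ ((1:ℝ)/4),
    (4096 ^ 2 * (9 + 32 * Real.log 64) / (4 * Real.log 64)) ^ ((1:ℝ)/4), by positivity,
    by positivity, 1, fun j hj => ?_⟩
  obtain ⟨hlo, hup⟩ := integral_LPpiece_pow_four_bounds j hj
  set X : ℝ := ((64 : ℝ) ^ 4) ^ (-(3 * (j : ℝ)) / 4) with hX
  have hX0 : 0 < X := by positivity
  have hX4 : X ^ 4 = 1 / ((64 : ℝ) ^ (2 * j)) ^ 6 := by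
    rw [hX, ← Real.rpow_natCast, ← Real.rpow_mul (by positivity),
      show -(3 * (j : ℝ)) / 4 * (4 : ℕ) = -((3 * j : ℕ) : ℝ) by push_cast; ring,
      Real.rpow_neg (by positivity), Real.rpow_natCast, one_div]
    congr 1
    rw [← pow_mul, ← pow_mul]
    congr 1
    ring
  have hL : Real.log (((64 : ℝ) ^ 4) ^ j) = 4 * j * Real.log 64 := by
    rw [Real.log_pow, Real.log_pow]
    push_cast
    ring
  have hL0 : 0 ≤ Real.log (((64 : ℝ) ^ 4) ^ j) := by
    rw [hL]
    positivity
  rw [← mul_pow_four_mul_rpow_quarter (by positivity) hX0.le hL0,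
    ← mul_pow_four_mul_rpow_quarter (by positivity) hX0.le hL0, hX4, hL]
  constructor
  · refine Real.rpow_le_rpow (by positivity) (le_trans (le_of_eq ?_) hlo) (by norm_num)
    field_simp
  · refine Real.rpow_le_rpow (le_trans (by positivity) hlo)
      (hup.trans (le_of_eq ?_)) (by norm_num)
    field_simp
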